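/- arXiv:2303.05455 — 5 statements merged into one kernel-verified Lean document; each statement's English description precedes it below -/
import Mathlib

section
/- Let k ≥ 1 and let d₁, …, d_k be real numbers with minimum ρ = min_j d_j, and let m = #{ j : d_j = ρ }. If m < log₂(k), then there exists σ > 0 such that Σ_{j=1}^k exp(−(d_j − ρ)/σ) = log₂(k). (In particular, the UMAP bandwidth equation is solvable whenever fewer than log₂(k) of the k neighbor distances equal the minimum distance.) -/
open Filter Topology in
/-- A finite sum of decaying exponentials with nonnegative rates tends to the number of zero rates. -/
theorem tendsto_sum_exp_neg_mul_atTop {ι : Type*} [Fintype ι] (a : ι → ℝ) (ha : ∀ j, 0 ≤ a j)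
    [DecidablePred fun j => a j = 0] :
    Tendsto (fun t : ℝ => ∑ j, Real.exp (-(a j * t))) atTop
      (𝓝 ((Finset.univ.filter fun j => a j = 0).card : ℝ)) := by
  rw [Finset.card_filter, Nat.cast_sum]
  refine tendsto_finsetSum _ fun j _ => ?_
  by_cases h : a j = 0
  · simp [h]
  · have hpos : 0 < a j := lt_of_le_of_ne (ha j) (Ne.symm h)
    simp only [h, if_false, Nat.cast_zero]
    exact Real.tendsto_exp_neg_atTop_nhds_zero.comp (tendsto_id.const_mul_atTop hpos)

theorem logb_two_natCast_lt {k : ℕ} (hk : 1 ≤ k) : Real.logb 2 k < k := by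
  rw [Real.logb_lt_iff_lt_rpow one_lt_two (by exact_mod_cast hk), Real.rpow_natCast]
  exact_mod_cast Nat.lt_two_pow_self

/-- Solvability of the UMAP bandwidth equation: if `ρ = min_j d_j` and the number `m` of neighbor
distances equal to the minimum satisfies `m < log₂ k`, then there exists `σ > 0` with
`Σ_j exp(-(d_j - ρ)/σ) = log₂ k`. -/
theorem stmt_9 (k : ℕ) (hk : 1 ≤ k) (d : Fin k → ℝ) (ρ : ℝ)
    (hρ_le : ∀ j, ρ ≤ d j) (hρ_mem : ∃ j, d j = ρ)
    (hm : ((Finset.univ.filter fun j => d j = ρ).card : ℝ) < Real.logb 2 k) :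
    ∃ σ : ℝ, 0 < σ ∧ ∑ j, Real.exp (-(d j - ρ)/σ) = Real.logb 2 k := by
  classical
  have hlim := tendsto_sum_exp_neg_mul_atTop (fun j => d j - ρ) fun j => sub_nonneg.2 (hρ_le j)
  simp only [sub_eq_zero] at hlim
  obtain ⟨T, hT, hT0⟩ :=
    ((hlim.eventually_lt_const hm).and (Filter.eventually_ge_atTop (0 : ℝ))).exists
  have hcont : ContinuousOn (fun t : ℝ => ∑ j, Real.exp (-((d j - ρ) * t))) (Set.Icc 0 T) := by
    fun_prop
  have hlog := logb_two_natCast_lt hk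
  obtain ⟨t, ht, hteq⟩ := intermediate_value_Icc' hT0 hcont
    (show Real.logb 2 k ∈ Set.Icc _ _ from ⟨hT.le, by simpa using hlog.le⟩)
  have ht0 : t ≠ 0 := by
    rintro rfl
    apply hlog.ne
    simpa using hteq.symm
  refine ⟨t⁻¹, inv_pos.2 (lt_of_le_of_ne ht.1 ht0.symm), ?_⟩
  simpa only [div_inv_eq_mul, neg_mul] using hteq
end

section
/- Let k ≥ 2 and let D₁, …, D_k be real numbers that are not all equal. For σ > 0 define the probability weights p_j(σ) = exp(−D_j/(2σ²)) / Σ_{l=1}^k exp(−D_l/(2σ²)) and the Shannon entropy H(σ) = −Σ_{j=1}^k p_j(σ) · log₂ p_j(σ). Then H is a strictly increasing function of σ on (0, ∞). -/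
/-- **Gibbs' inequality**, strict form: the cross-entropy of two distinct positive weight vectors
of equal total mass exceeds the entropy of the first. -/
theorem sum_mul_log_lt_sum_mul_log_self {ι : Type*} [Fintype ι] {p q : ι → ℝ}
    (hp : ∀ i, 0 < p i) (hq : ∀ i, 0 < q i) (hsum : ∑ i, p i = ∑ i, q i) (hne : p ≠ q) :
    ∑ i, p i * Real.log (q i) < ∑ i, p i * Real.log (p i) := by
  have key : ∀ i, p i * Real.log (q i) - p i * Real.log (p i) = p i * Real.log (q i / p i) := by
    intro i
    rw [Real.log_div (hq i).ne' (hp i).ne']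
    ring
  have cancel : ∀ i, p i * (q i / p i - 1) = q i - p i := by
    intro i
    have := (hp i).ne'
    field_simp
  obtain ⟨i₀, hi₀⟩ := Function.ne_iff.mp hne
  have hlt : ∑ i, (p i * Real.log (q i) - p i * Real.log (p i)) < ∑ i, (q i - p i) := by
    refine Finset.sum_lt_sum (fun i _ => ?_) ⟨i₀, Finset.mem_univ _, ?_⟩
    · rw [key, ← cancel]
      exact mul_le_mul_of_nonneg_left
        (Real.log_le_sub_one_of_pos (div_pos (hq i) (hp i))) (hp i).le
    · rw [key, ← cancel]
      refine mul_lt_mul_of_pos_left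
        (Real.log_lt_sub_one_of_pos (div_pos (hq i₀) (hp i₀)) fun h => hi₀ ?_) (hp i₀)
      exact ((div_eq_one_iff_eq (hp i₀).ne').mp h).symm
  rw [Finset.sum_sub_distrib, Finset.sum_sub_distrib] at hlt
  linarith

/-- The Gibbs distribution of the energies `D` at inverse temperature `b`. -/
noncomputable def gibbsWeight {ι : Type*} [Fintype ι] (D : ι → ℝ) (b : ℝ) (j : ι) : ℝ :=
  Real.exp (-(b * D j)) / ∑ l, Real.exp (-(b * D l))

section gibbsWeight

variable {ι : Type*} [Fintype ι] [Nonempty ι] (D : ι → ℝ)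

theorem sum_exp_neg_mul_pos (b : ℝ) : 0 < ∑ l, Real.exp (-(b * D l)) :=
  Finset.sum_pos (fun _ _ => Real.exp_pos _) Finset.univ_nonempty

theorem gibbsWeight_pos (b : ℝ) (j : ι) : 0 < gibbsWeight D b j :=
  div_pos (Real.exp_pos _) (sum_exp_neg_mul_pos D b)

theorem sum_gibbsWeight (b : ℝ) : ∑ j, gibbsWeight D b j = 1 := by
  simp only [gibbsWeight]
  rw [← Finset.sum_div, div_self (sum_exp_neg_mul_pos D b).ne']

theorem log_gibbsWeight (b : ℝ) (j : ι) :
    Real.log (gibbsWeight D b j) = -(b * D j) - Real.log (∑ l, Real.exp (-(b * D l))) := by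
  rw [gibbsWeight, Real.log_div (Real.exp_pos _).ne' (sum_exp_neg_mul_pos D b).ne', Real.log_exp]

theorem sum_gibbsWeight_mul_log (b c : ℝ) :
    ∑ j, gibbsWeight D b j * Real.log (gibbsWeight D c j) =
      -(c * ∑ j, gibbsWeight D b j * D j) - Real.log (∑ l, Real.exp (-(c * D l))) := by
  have h : ∀ j, gibbsWeight D b j * Real.log (gibbsWeight D c j) =
      -c * (gibbsWeight D b j * D j) -
        gibbsWeight D b j * Real.log (∑ l, Real.exp (-(c * D l))) := by
    intro j
    rw [log_gibbsWeight]
    ring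
  rw [Finset.sum_congr rfl fun j _ => h j, Finset.sum_sub_distrib, ← Finset.mul_sum,
    ← Finset.sum_mul, sum_gibbsWeight]
  ring

theorem gibbsWeight_ne {D : ι → ℝ} (hD : ¬ ∀ i j, D i = D j) {b c : ℝ} (hbc : b ≠ c) :
    gibbsWeight D b ≠ gibbsWeight D c := by
  refine fun h => hD fun i j => ?_
  have hi := congrArg Real.log (congrFun h i)
  have hj := congrArg Real.log (congrFun h j)
  rw [log_gibbsWeight, log_gibbsWeight] at hi hj
  exact mul_left_cancel₀ (sub_ne_zero.mpr hbc) (by linarith)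

/-- The entropy of a nonconstant Gibbs distribution decreases strictly with the inverse
temperature. -/
theorem sum_gibbsWeight_mul_log_lt {D : ι → ℝ} (hD : ¬ ∀ i j, D i = D j) {b c : ℝ}
    (hc : 0 < c) (hcb : c < b) :
    ∑ j, gibbsWeight D c j * Real.log (gibbsWeight D c j) <
      ∑ j, gibbsWeight D b j * Real.log (gibbsWeight D b j) := by
  have gibbs : ∀ {x y : ℝ}, x ≠ y → _ := fun {x y} hxy =>
    sum_mul_log_lt_sum_mul_log_self (gibbsWeight_pos D x) (gibbsWeight_pos D y)
      ((sum_gibbsWeight D x).trans (sum_gibbsWeight D y).symm) (gibbsWeight_ne hD hxy)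
  have h₁ := gibbs hcb.ne'
  have h₂ := gibbs hcb.ne
  simp only [sum_gibbsWeight_mul_log] at h₁ h₂ ⊢
  have hmean : ∑ j, gibbsWeight D b j * D j < ∑ j, gibbsWeight D c j * D j :=
    lt_of_mul_lt_mul_left (a := b - c) (by linarith) (sub_pos.mpr hcb).le
  linarith [mul_lt_mul_of_pos_left hmean hc]

end gibbsWeight

/-- Monotonicity of the Shannon entropy of the Gaussian softmax in SNE: for squared distances
`D₁, …, D_k` (not all equal), the entropy `H(σ) = -Σ_j p_j(σ) log₂ p_j(σ)` of the distribution
`p_j(σ) = exp(-D_j/(2σ²)) / Σ_l exp(-D_l/(2σ²))` is strictly increasing in `σ` on `(0, ∞)`. -/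
theorem stmt_10 (k : ℕ) (hk : 2 ≤ k) (D : Fin k → ℝ) (hD : ¬ ∀ i j, D i = D j) :
    StrictMonoOn (fun σ : ℝ =>
      -∑ j, (Real.exp (-(D j)/(2*σ^2)) / ∑ l, Real.exp (-(D l)/(2*σ^2))) *
        Real.logb 2 (Real.exp (-(D j)/(2*σ^2)) / ∑ l, Real.exp (-(D l)/(2*σ^2))))
      (Set.Ioi 0) := by
  have : Nonempty (Fin k) := ⟨⟨0, by omega⟩⟩
  intro σ hσ τ hτ hστ
  rw [Set.mem_Ioi] at hσ hτ
  have hexp : ∀ (s : ℝ) (j : Fin k), -(D j) / (2 * s ^ 2) = -((2 * s ^ 2)⁻¹ * D j) := by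
    intro s j
    ring
  have hweight : ∀ (b : ℝ) (j : Fin k),
      Real.exp (-(b * D j)) / ∑ l, Real.exp (-(b * D l)) = gibbsWeight D b j :=
    fun _ _ => rfl
  simp only [hexp, hweight, Real.logb, ← mul_div_assoc, ← Finset.sum_div]
  refine neg_lt_neg (div_lt_div_of_pos_right ?_ (Real.log_pos one_lt_two))
  refine sum_gibbsWeight_mul_log_lt hD (by positivity) ?_
  gcongr
end

section
/- Fix n ≥ 1 and M ≥ 2. Let p_{ij} (for i ≠ j, 1 ≤ i, j ≤ M) be real numbers with p_{ij} = p_{ji} > 0 and Σ_{i≠j} p_{ij} = 1. For points y₁, …, y_M ∈ ℝ^n define q_{ij}(y) = exp(−‖y_i − y_j‖²) / Σ_{k≠l} exp(−‖y_k − y_l‖²) for i ≠ j, and the cost C(y) = Σ_{i≠j} p_{ij} · log(p_{ij}/q_{ij}(y)). Then, for each index i, the function z ↦ C(y₁, …, y_{i−1}, z, y_{i+1}, …, y_M) is differentiable at z = y_i, and its gradient there equals 4 · Σ_{j≠i} (p_{ij} − q_{ij}(y)) · (y_i − y_j). -/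
/-- Differentiating the squared distance between two points of a configuration with respect to the
position of the `i`-th point. -/
lemma hasGradientAt_norm_sub_sq_update {ι E : Type*} [DecidableEq ι] [NormedAddCommGroup E]
    [InnerProductSpace ℝ E] [CompleteSpace E] (y : ι → E) (i a b : ι) :
    HasGradientAt (fun z => ‖Function.update y i z a - Function.update y i z b‖ ^ 2)
      ((2 * ((if a = i then 1 else 0) - (if b = i then 1 else 0)) : ℝ) • (y a - y b)) (y i) := by
  have hupdate (k : ι) : HasFDerivAt (fun z => Function.update y i z k)
      ((if k = i then 1 else 0 : ℝ) • ContinuousLinearMap.id ℝ E) (y i) := by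
    by_cases hk : k = i
    · subst hk
      simp only [Function.update_self, if_true, one_smul]
      exact hasFDerivAt_id (y k)
    · simpa [hk] using hasFDerivAt_const (y k) (y i)
  rw [hasGradientAt_iff_hasFDerivAt]
  refine ((hupdate a).sub (hupdate b)).norm_sq.congr_fderiv ?_
  ext v
  split_ifs <;> simp <;> ring

/-- A symmetrically weighted sum over ordered pairs of the gradients in
`hasGradientAt_norm_sub_sq_update` only sees the pairs containing `i`, each of them twice. -/
lemma sum_offDiag_smul_sub_eq {ι E : Type*} [Fintype ι] [DecidableEq ι] [AddCommGroup E]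
    [Module ℝ E] (c : ι → ι → ℝ) (hc : ∀ a b, c a b = c b a) (y : ι → E) (i : ι) :
    ∑ a, ∑ b ∈ Finset.univ \ {a},
        c a b • (2 * ((if a = i then 1 else 0) - (if b = i then 1 else 0)) : ℝ) • (y a - y b) =
      (4 : ℝ) • ∑ j ∈ Finset.univ \ {i}, c i j • (y i - y j) := by
  have hdiag (a : ι) (f : ι → E) (hf : f a = 0) :
      ∑ b ∈ Finset.univ \ {a}, f b = ∑ b, f b :=
    Finset.sum_subset (Finset.subset_univ _) fun b _ hb => by
      obtain rfl : b = a := by simpa using hb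
      exact hf
  have hsplit (a b : ι) :
      c a b • (2 * ((if a = i then 1 else 0) - (if b = i then 1 else 0)) : ℝ) • (y a - y b) =
        (if a = i then (2 : ℝ) • c i b • (y i - y b) else 0) +
          (if b = i then (2 : ℝ) • c i a • (y i - y a) else 0) := by
    by_cases ha : a = i <;> by_cases hb : b = i
    · subst ha hb; simp
    · subst ha; simp [hb, smul_smul, mul_comm]
    · subst hb; simp only [ha, hc b a, if_true, if_false]; module
    · simp [ha, hb]
  rw [hdiag i _ (by simp), Finset.sum_congr rfl fun a _ => hdiag a _ (by simp)]
  simp only [hsplit, Finset.sum_add_distrib]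
  rw [Finset.sum_comm]
  simp only [Finset.sum_ite_eq', Finset.mem_univ, if_true, ← Finset.smul_sum]
  module

/-- The Kullback–Leibler cost splits into a weighted sum of energies and the logarithm of the
partition function. -/
lemma sum_mul_log_div_gibbs {ι : Type*} [Fintype ι] [DecidableEq ι] (p d : ι → ι → ℝ)
    (hpos : ∀ i j, i ≠ j → 0 < p i j) (hsum : ∑ i, ∑ j ∈ Finset.univ \ {i}, p i j = 1)
    {Z : ℝ} (hZ : 0 < Z) :
    ∑ a, ∑ b ∈ Finset.univ \ {a}, p a b * Real.log (p a b / (Real.exp (-d a b) / Z)) =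
      (∑ a, ∑ b ∈ Finset.univ \ {a}, p a b * (Real.log (p a b) + d a b)) + Real.log Z := by
  rw [← one_mul (Real.log Z), ← hsum]
  simp only [Finset.sum_mul, ← Finset.sum_add_distrib]
  refine Finset.sum_congr rfl fun a _ => Finset.sum_congr rfl fun b hb => ?_
  have hab : a ≠ b := by
    rintro rfl
    simp at hb
  rw [Real.log_div (hpos a b hab).ne' (by positivity),
    Real.log_div (Real.exp_pos _).ne' hZ.ne', Real.log_exp]
  ring

lemma sum_offDiag_exp_pos {ι : Type*} [Fintype ι] [DecidableEq ι] [Nontrivial ι]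
    (d : ι → ι → ℝ) : 0 < ∑ a, ∑ b ∈ Finset.univ \ {a}, Real.exp (d a b) := by
  refine Finset.sum_pos (fun a _ => Finset.sum_pos (fun b _ => Real.exp_pos _) ?_)
    Finset.univ_nonempty
  obtain ⟨b, hb⟩ := exists_ne a
  exact ⟨b, by simpa using hb⟩

/-- Gradient of the symmetric SNE Kullback–Leibler cost: with fixed symmetric positive pair
probabilities `p` summing to `1` over ordered pairs `a ≠ b`, embedded points
`y₁, …, y_M ∈ ℝ^n`, Gaussian pair probabilities
`q_{ab}(w) = exp(-‖w_a - w_b‖²) / Σ_{c≠e} exp(-‖w_c - w_e‖²)` and cost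
`C(w) = Σ_{a≠b} p_{ab} log(p_{ab}/q_{ab}(w))`, the map `z ↦ C(y[i := z])` has gradient
`4 Σ_{j≠i} (p_{ij} - q_{ij}(y)) (y_i - y_j)` at `z = y_i`. -/
theorem stmt_11 (n M : ℕ) (hn : 1 ≤ n) (hM : 2 ≤ M)
    (p : Fin M → Fin M → ℝ)
    (hsymm : ∀ i j, p i j = p j i)
    (hpos : ∀ i j, i ≠ j → 0 < p i j)
    (hsum : ∑ i, ∑ j ∈ Finset.univ \ {i}, p i j = 1)
    (y : Fin M → EuclideanSpace ℝ (Fin n)) (i : Fin M) :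
    HasGradientAt
      (fun z : EuclideanSpace ℝ (Fin n) =>
        ∑ a, ∑ b ∈ Finset.univ \ {a},
          p a b * Real.log (p a b /
            (Real.exp (-‖Function.update y i z a - Function.update y i z b‖^2) /
              ∑ c, ∑ e ∈ Finset.univ \ {c},
                Real.exp (-‖Function.update y i z c - Function.update y i z e‖^2))))
      ((4:ℝ) • ∑ j ∈ Finset.univ \ {i},
        (p i j - Real.exp (-‖y i - y j‖^2) /
            ∑ c, ∑ e ∈ Finset.univ \ {c}, Real.exp (-‖y c - y e‖^2)) • (y i - y j))
      (y i) := by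
  have : Nontrivial (Fin M) := Fin.nontrivial_iff_two_le.mpr hM
  set Z : ℝ := ∑ c, ∑ e ∈ Finset.univ \ {c}, Real.exp (-‖y c - y e‖^2)
  have hZpos : 0 < Z := sum_offDiag_exp_pos _
  have hd (a b : Fin M) := (hasGradientAt_norm_sub_sq_update y i a b).hasFDerivAt
  have hq : HasFDerivAt _ _ (y i) := HasFDerivAt.fun_sum (u := Finset.univ) fun c _ =>
    HasFDerivAt.fun_sum (u := Finset.univ \ {c}) fun e _ => (hd c e).fun_neg.exp
  simp only [Function.update_eq_self] at hq
  have hlogZ := hq.log (by simpa only [Function.update_eq_self] using hZpos.ne')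
  have henergy : HasFDerivAt _ _ (y i) := HasFDerivAt.fun_sum (u := Finset.univ) fun a _ =>
    HasFDerivAt.fun_sum (u := Finset.univ \ {a}) fun b _ =>
      ((hd a b).const_add (Real.log (p a b))).const_mul (p a b)
  simp only [sum_mul_log_div_gibbs p _ hpos hsum (sum_offDiag_exp_pos _)]
  rw [← sum_offDiag_smul_sub_eq (fun a b => p a b - Real.exp (-‖y a - y b‖^2) / Z)
    (fun a b => by rw [hsymm a b, norm_sub_rev]) y i, hasGradientAt_iff_hasFDerivAt]
  refine (henergy.add hlogZ).congr_fderiv ?_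
  simp only [Function.update_eq_self, map_sum, Finset.smul_sum, ← Finset.sum_add_distrib]
  refine Finset.sum_congr rfl fun a _ => Finset.sum_congr rfl fun b _ => ?_
  ext v
  simp [-Finset.sum_sdiff_eq_sub]
  ring
end

section
/- Let V be a real vector space, let λ, k, Δt ∈ ℝ with 1 + λΔt/2 ≠ 0, and let f, v_prev, v_next ∈ V and r₀, r₁, r₂ ∈ V. Suppose the leapfrog relations hold: v_next = v_prev + Δt · (2k · f − λ · ((v_next + v_prev)/2)), r₁ − r₀ = Δt · v_prev, and r₂ = r₁ + Δt · v_next. Then r₂ − r₁ = a · (r₁ − r₀) + b · f, where a = (1 − λΔt/2)/(1 + λΔt/2) and b = 2kΔt²/(1 + λΔt/2); in particular the leapfrog force-directed update coincides with the momentum update Δr ← a·Δr + b·f with a/b = (1 − λΔt/2)/(2kΔt). -/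
/-- The leapfrog force-directed update coincides with the momentum update: if
`v_next = v_prev + Δt (2k f - λ (v_next + v_prev)/2)`, `r₁ - r₀ = Δt v_prev` and
`r₂ = r₁ + Δt v_next`, then `r₂ - r₁ = a (r₁ - r₀) + b f` with
`a = (1 - λΔt/2)/(1 + λΔt/2)` and `b = 2kΔt²/(1 + λΔt/2)`. -/
theorem stmt_14 (V : Type*) [AddCommGroup V] [Module ℝ V]
    (lam k dt : ℝ) (h : 1 + lam * dt / 2 ≠ 0)
    (f vprev vnext r0 r1 r2 : V)
    (hv : vnext = vprev + dt • ((2 * k) • f - lam • ((2:ℝ)⁻¹ • (vnext + vprev))))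
    (hr1 : r1 - r0 = dt • vprev)
    (hr2 : r2 = r1 + dt • vnext) :
    r2 - r1 = ((1 - lam * dt / 2)/(1 + lam * dt / 2)) • (r1 - r0) +
      ((2 * k * dt^2)/(1 + lam * dt / 2)) • f := by
  have key : (1 + lam * dt / 2) • vnext = (1 - lam * dt / 2) • vprev + (2 * k * dt) • f := by
    linear_combination (norm := module) hv
  rw [hr1, hr2, add_sub_cancel_left]
  apply smul_right_injective V h
  simp only [smul_add, smul_smul, mul_div_cancel₀ _ h]
  rw [mul_comm, mul_smul, key, ← mul_assoc, mul_div_cancel₀ _ h]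
  module
end

section
/- Let 1 < q < 3, σ > 0 and μ ∈ ℝ. Then the q-Gaussian density kernel is integrable on ℝ and ∫_ℝ (1 + ((q−1)/(3−q)) · ((s−μ)²/σ²))^{−1/(q−1)} ds = σ · √((3−q)/(q−1)) · Γ((3−q)/(2(q−1))) · Γ(1/2) / Γ(1/(q−1)); that is, the normalization factor of the q-Gaussian distribution equals Z_q = √((3−q)/(q−1)) · B((3−q)/(2(q−1)), 1/2) · σ. -/
open MeasureTheory

theorem rpow_mul_exp_neg_one_add_sq_mul (a t x : ℝ) :
    t ^ a * Real.exp (-((1 + x ^ 2) * t)) =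
      t ^ a * Real.exp (-t) * Real.exp (-t * x ^ 2) := by
  rw [mul_assoc, ← Real.exp_add]
  ring_nf

theorem integral_rpow_mul_exp_neg_one_add_sq_mul (p : ℝ) {t : ℝ} (ht : 0 < t) :
    ∫ x : ℝ, t ^ (p - 1) * Real.exp (-((1 + x ^ 2) * t)) =
      √Real.pi * (Real.exp (-t) * t ^ (p - 1 / 2 - 1)) := by
  simp only [rpow_mul_exp_neg_one_add_sq_mul]
  rw [integral_const_mul, integral_gaussian, Real.sqrt_div Real.pi_pos.le, Real.sqrt_eq_rpow t,
    show p - 1 / 2 - 1 = p - 1 - 1 / 2 by ring, Real.rpow_sub ht (p - 1) (1 / 2)]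
  ring

/-- The integrand `t ^ (p - 1) * exp (-t (1 + x²))`, which connects `(1 + x²) ^ (-p)` to the Gamma
function, is integrable in `(x, t)` on `ℝ × (0, ∞)`. -/
theorem integrable_rpow_mul_exp_neg_one_add_sq_mul {p : ℝ} (hp : 1 / 2 < p) :
    Integrable (fun z : ℝ × ℝ => z.2 ^ (p - 1) * Real.exp (-((1 + z.1 ^ 2) * z.2)))
      (volume.prod (volume.restrict (Set.Ioi 0))) := by
  rw [integrable_prod_iff' (Measurable.aestronglyMeasurable (by fun_prop))]
  constructor
  · filter_upwards [ae_restrict_mem measurableSet_Ioi] with t ht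
    simp only [rpow_mul_exp_neg_one_add_sq_mul]
    exact (integrable_exp_neg_mul_sq ht).const_mul _
  · have hΓ := (Real.GammaIntegral_convergent (s := p - 1 / 2) (by linarith)).const_mul (√Real.pi)
    refine hΓ.congr ?_
    filter_upwards [ae_restrict_mem measurableSet_Ioi] with t (ht : 0 < t)
    rw [← integral_rpow_mul_exp_neg_one_add_sq_mul p ht]
    exact integral_congr_ae (.of_forall fun x => (Real.norm_of_nonneg (by positivity)).symm)

theorem integrable_one_add_sq_rpow_neg {p : ℝ} (hp : 1 / 2 < p) :
    Integrable (fun x : ℝ => (1 + x ^ 2) ^ (-p)) := by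
  have h := integrable_rpow_neg_one_add_norm_sq (E := ℝ) (μ := volume) (r := 2 * p)
    (by simp; linarith)
  simpa [neg_div] using h

theorem integral_one_add_sq_rpow_neg {p : ℝ} (hp : 1 / 2 < p) :
    ∫ x : ℝ, (1 + x ^ 2) ^ (-p) =
      Real.Gamma (p - 1 / 2) * Real.Gamma (1 / 2) / Real.Gamma p := by
  have hp0 : 0 < p := by linarith
  have hswap := integral_integral_swap
    (f := fun x t : ℝ => t ^ (p - 1) * Real.exp (-((1 + x ^ 2) * t)))
    (integrable_rpow_mul_exp_neg_one_add_sq_mul hp)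
  have hleft (x : ℝ) :
      ∫ t in Set.Ioi (0 : ℝ), t ^ (p - 1) * Real.exp (-((1 + x ^ 2) * t)) =
        (1 + x ^ 2) ^ (-p) * Real.Gamma p := by
    rw [Real.integral_rpow_mul_exp_neg_mul_Ioi hp0 (by positivity), one_div,
      Real.inv_rpow (by positivity), Real.rpow_neg (by positivity)]
  have hright : ∫ t in Set.Ioi (0 : ℝ), ∫ x : ℝ, t ^ (p - 1) * Real.exp (-((1 + x ^ 2) * t)) =
      √Real.pi * Real.Gamma (p - 1 / 2) := by
    rw [Real.Gamma_eq_integral (by linarith), ← integral_const_mul]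
    exact setIntegral_congr_fun measurableSet_Ioi fun t ht =>
      integral_rpow_mul_exp_neg_one_add_sq_mul p ht
  simp only [hleft] at hswap
  rw [hright, integral_mul_const] at hswap
  rw [Real.Gamma_one_half_eq, eq_div_iff (Real.Gamma_pos_of_pos hp0).ne', hswap, mul_comm]

/-- Normalization of the q-Gaussian distribution for `1 < q < 3`: the kernel
`s ↦ (1 + ((q-1)/(3-q))((s-μ)²/σ²))^{-1/(q-1)}` is integrable on `ℝ` and its integral equals
`σ √((3-q)/(q-1)) Γ((3-q)/(2(q-1))) Γ(1/2) / Γ(1/(q-1))`, i.e. the normalization factor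
`Z_q = √((3-q)/(q-1)) B((3-q)/(2(q-1)), 1/2) σ`. -/
theorem stmt_16 (q σ μ : ℝ) (hq1 : 1 < q) (hq3 : q < 3) (hσ : 0 < σ) :
    Integrable (fun s : ℝ => (1 + ((q-1)/(3-q)) * ((s-μ)^2/σ^2)) ^ (-(1/(q-1)))) ∧
    ∫ s : ℝ, (1 + ((q-1)/(3-q)) * ((s-μ)^2/σ^2)) ^ (-(1/(q-1))) =
      σ * Real.sqrt ((3-q)/(q-1)) * Real.Gamma ((3-q)/(2*(q-1))) * Real.Gamma (1/2) /
        Real.Gamma (1/(q-1)) := by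
  have hq1' : 0 < q - 1 := by linarith
  have hq3' : 0 < 3 - q := by linarith
  have hp : 1 / 2 < 1 / (q - 1) := one_div_lt_one_div_of_lt hq1' (by linarith)
  have hscale : 0 < σ * √((3 - q) / (q - 1)) := by positivity
  have hkernel (s : ℝ) : (1 + ((q-1)/(3-q)) * ((s-μ)^2/σ^2)) ^ (-(1/(q-1))) =
      (1 + ((σ * √((3 - q) / (q - 1)))⁻¹ * (s - μ)) ^ 2) ^ (-(1/(q-1))) := by
    congr 2
    rw [mul_pow, inv_pow, mul_pow, Real.sq_sqrt (by positivity)]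
    field_simp
  simp only [hkernel]
  refine ⟨((integrable_one_add_sq_rpow_neg hp).comp_mul_left'
    (inv_ne_zero hscale.ne')).comp_sub_right μ, ?_⟩
  rw [integral_sub_right_eq_self
      (fun s => (1 + ((σ * √((3 - q) / (q - 1)))⁻¹ * s) ^ 2) ^ (-(1/(q-1)))) μ,
    Measure.integral_comp_mul_left (fun x => (1 + x ^ 2) ^ (-(1/(q-1)))),
    integral_one_add_sq_rpow_neg hp, inv_inv, abs_of_pos hscale, smul_eq_mul,
    show 1 / (q - 1) - 1 / 2 = (3 - q) / (2 * (q - 1)) by field_simp; ring]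
  ring
end
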